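/- Let G be a connected simple graph on {1,…,n} and let G denote its toppling group, the subgroup {T^a : a ∈ ℤ^n} of the group of bijections of ℤ^n under composition. Then the group algebra ℂ[G] is isomorphic, as a ℂ-algebra, to the quotient ring ℂ[x_1, x_2, …, x_n] / ⟨1 − x_1·x_2·⋯·x_n⟩. -/

import Mathlib

open Finset

/-- The toppling vector `Δ_i` of vertex `i` in the graph `G`:
it has `-(deg i)` at position `i`, `1` at each neighbor of `i`, and `0` elsewhere. -/
def topDelta {n : ℕ} (G : SimpleGraph (Fin n)) [DecidableRel G.Adj] (i : Fin n) :
    Fin n → ℤ :=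
  fun j => if j = i then -(G.degree i : ℤ) else if G.Adj i j then 1 else 0

/-- The map `T^a : ℤ^n → ℤ^n`, `α ↦ α + Σ_i a_i • Δ_i`. -/
def topT {n : ℕ} (G : SimpleGraph (Fin n)) [DecidableRel G.Adj] (a : Fin n → ℤ)
    (α : Fin n → ℤ) : Fin n → ℤ :=
  α + ∑ i, a i • topDelta G i

/-- Toppling dominance: `β ≤ α` iff `β = T^λ(α)` for some weakly decreasing `λ ∈ ℕ^n`. -/
def topDom {n : ℕ} (G : SimpleGraph (Fin n)) [DecidableRel G.Adj]
    (β α : Fin n → ℤ) : Prop :=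
  ∃ l : Fin n → ℕ, Antitone l ∧ β = topT G (fun i => (l i : ℤ)) α

/-- `T^a` as a bijection of `ℤ^n` (it is the translation by `Σ_i a_i • Δ_i`). -/
def topPerm {n : ℕ} (G : SimpleGraph (Fin n)) [DecidableRel G.Adj]
    (a : Fin n → ℤ) : Equiv.Perm (Fin n → ℤ) :=
  Equiv.addRight (∑ i, a i • topDelta G i)

/-- The toppling group of `G`: the subgroup `{T^a : a ∈ ℤ^n}` of the group of
bijections of `ℤ^n` under composition. -/
def topplingGroup {n : ℕ} (G : SimpleGraph (Fin n)) [DecidableRel G.Adj] :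
    Subgroup (Equiv.Perm (Fin n → ℤ)) :=
  Subgroup.closure (Set.range (topPerm G))

/-- The group algebra of a quotient of `ℤ^ι` by its constant vectors is the quotient of the
polynomial ring in variables indexed by `ι` by the relation `∏ i, X i = 1`. -/
theorem nonempty_monoidAlgebra_algEquiv_of_ker_eq_const {R ι H : Type*} [CommRing R] [Fintype ι]
    [DecidableEq ι] [CommGroup H] (f : Multiplicative (ι → ℤ) →* H)
    (hf : Function.Surjective f)
    (hker : ∀ a : ι → ℤ, f (Multiplicative.ofAdd a) = 1 ↔ ∃ c : ℤ, a = fun _ => c) :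
    Nonempty (MonoidAlgebra R H ≃ₐ[R]
      (MvPolynomial ι R ⧸ Ideal.span {(1 : MvPolynomial ι R) - ∏ i, MvPolynomial.X i})) := by
  set I := Ideal.span {(1 : MvPolynomial ι R) - ∏ i, MvPolynomial.X i} with hI
  let x : ι → MvPolynomial ι R ⧸ I := fun i => Ideal.Quotient.mk I (MvPolynomial.X i)
  have hx : ∏ i, x i = 1 := by
    rw [← map_prod, ← map_one (Ideal.Quotient.mk I), eq_comm, Ideal.Quotient.mk_eq_mk_iff_sub_mem]
    exact Ideal.mem_span_singleton_self _
  let u : ι → (MvPolynomial ι R ⧸ I)ˣ := fun i =>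
    Units.mkOfMulEqOne (x i) (∏ j ∈ univ.erase i, x j) (by
      rw [mul_prod_erase univ x (mem_univ i), hx])
  have hu : ∏ i, u i = 1 := by
    ext
    simpa [u, Units.coe_prod] using hx
  let g : Multiplicative (ι → ℤ) →* (MvPolynomial ι R ⧸ I)ˣ :=
    { toFun := fun a => ∏ i, u i ^ (a.toAdd i)
      map_one' := by simp
      map_mul' := fun a b => by simp [zpow_add, prod_mul_distrib] }
  have hg : f.ker ≤ g.ker := by
    intro a ha
    obtain ⟨c, hc⟩ := (hker a.toAdd).1 ha
    change ∏ i, u i ^ (a.toAdd i) = 1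
    simp only [hc]
    exact (Finset.prod_zpow u univ c).trans (by rw [hu, one_zpow])
  have hgs : ∀ i, g (Multiplicative.ofAdd (Pi.single i 1)) = u i := by
    intro i
    change ∏ j, u j ^ ((Pi.single i 1 : ι → ℤ) j) = u i
    rw [prod_eq_single i] <;> simp +contextual
  let k : H →* (MvPolynomial ι R ⧸ I)ˣ := MonoidHom.liftOfSurjective f hf ⟨g, hg⟩
  have hk : ∀ a, k (f a) = g a := MonoidHom.liftOfRightInverse_comp_apply f _ _ ⟨g, hg⟩
  let y : ι → H := fun i => f (Multiplicative.ofAdd (Pi.single i 1))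
  have hy : ∏ i, y i = 1 := by
    rw [← map_prod, ← ofAdd_sum, hker]
    exact ⟨1, by ext j; simp [Finset.sum_apply, Pi.single_apply]⟩
  let φ : (MvPolynomial ι R ⧸ I) →ₐ[R] MonoidAlgebra R H :=
    Ideal.Quotient.liftₐ I (MvPolynomial.aeval fun i => MonoidAlgebra.of R H (y i)) (by
      suffices I ≤ RingHom.ker (MvPolynomial.aeval (R := R) fun i => MonoidAlgebra.of R H (y i))
        from fun a ha => this ha
      rw [hI, Ideal.span_singleton_le_iff_mem, RingHom.mem_ker, map_sub, map_prod, map_one]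
      simp only [MvPolynomial.aeval_X]
      rw [← map_prod, hy, map_one, sub_self])
  have hφx : ∀ i, φ (x i) = MonoidAlgebra.of R H (y i) := fun i =>
    MvPolynomial.aeval_X _ i
  let ψ : MonoidAlgebra R H →ₐ[R] (MvPolynomial ι R ⧸ I) :=
    MonoidAlgebra.lift R _ H ((Units.coeHom _).comp k)
  have hψ : ∀ h, ψ (MonoidAlgebra.of R H h) = k h := fun h => MonoidAlgebra.lift_of _ h
  refine ⟨AlgEquiv.ofAlgHom ψ φ ?_ ?_⟩
  · refine Ideal.Quotient.algHom_ext _ (MvPolynomial.algHom_ext fun i => ?_)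
    change ψ (φ (x i)) = x i
    rw [hφx, hψ, hk, hgs]
    rfl
  · have key : (Units.map (φ : _ →* MonoidAlgebra R H)).comp g =
        (MonoidAlgebra.of R H).toHomUnits.comp f := by
      have hu' : ∀ i, Units.map (φ : _ →* MonoidAlgebra R H) (u i) =
          (MonoidAlgebra.of R H).toHomUnits (y i) := fun i => Units.ext (hφx i)
      refine MonoidHom.ext fun a => ?_
      change Units.map (φ : _ →* MonoidAlgebra R H) (∏ i, u i ^ (a.toAdd i)) =
        (MonoidAlgebra.of R H).toHomUnits (f a)
      rw [map_prod]
      simp only [map_zpow, hu']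
      simp only [← map_zpow, ← map_prod, y, ← ofAdd_zsmul, ← ofAdd_sum]
      congr 2
      ext j
      simp [Finset.sum_apply, Pi.single_apply]
    refine (MonoidAlgebra.lift R _ H).symm.injective (MonoidHom.ext fun h => ?_)
    obtain ⟨a, rfl⟩ := hf h
    change φ (ψ (MonoidAlgebra.of R H (f a))) = MonoidAlgebra.of R H (f a)
    rw [hψ, hk]
    exact congrArg Units.val (DFunLike.congr_fun key a)

theorem sum_smul_topDelta_apply {n : ℕ} (G : SimpleGraph (Fin n)) [DecidableRel G.Adj]
    (a : Fin n → ℤ) (j : Fin n) :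
    (∑ i, a i • topDelta G i) j = -(G.lapMatrix ℤ).mulVec a j := by
  rw [G.lapMatrix_mulVec_apply, Finset.sum_apply, ← add_sum_erase _ _ (mem_univ j)]
  have h : ∀ i ∈ univ.erase j, (a i • topDelta G i) j = if G.Adj j i then a i else 0 := by
    intro i hi
    simp [topDelta, (ne_of_mem_erase hi).symm, G.adj_comm]
  rw [sum_congr rfl h, ← sum_filter, SimpleGraph.neighborFinset_eq_filter,
    filter_erase, erase_eq_of_notMem (by simp)]
  simp [topDelta]
  ring

/-- On a connected graph, topplings combine to the zero vector exactly when all vertices are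
toppled equally often. -/
theorem sum_smul_topDelta_eq_zero_iff {n : ℕ} (hn : 0 < n) (G : SimpleGraph (Fin n))
    [DecidableRel G.Adj] (hG : G.Connected) (a : Fin n → ℤ) :
    ∑ i, a i • topDelta G i = 0 ↔ ∃ c : ℤ, a = fun _ => c := by
  have hreal : ∑ i, a i • topDelta G i = 0 ↔
      (G.lapMatrix ℝ).mulVec (fun i => (a i : ℝ)) = 0 := by
    simp only [funext_iff, sum_smul_topDelta_apply, SimpleGraph.lapMatrix_mulVec_apply,
      Pi.zero_apply, neg_eq_zero]
    exact forall_congr' fun j => by exact_mod_cast Iff.rfl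
  rw [hreal, SimpleGraph.lapMatrix_mulVec_eq_zero_iff_forall_reachable]
  constructor
  · intro h
    exact ⟨a ⟨0, hn⟩, funext fun i => by exact_mod_cast h i ⟨0, hn⟩ (hG.preconnected _ _)⟩
  · rintro ⟨c, rfl⟩ i j -
    rfl

/-- The homomorphism `a ↦ T^a` from `ℤ^n` to the bijections of `ℤ^n`. -/
def topPermHom {n : ℕ} (G : SimpleGraph (Fin n)) [DecidableRel G.Adj] :
    Multiplicative (Fin n → ℤ) →* Equiv.Perm (Fin n → ℤ) where
  toFun a := topPerm G a.toAdd
  map_one' := by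
    ext
    simp [topPerm]
  map_mul' a b := by
    ext
    simp [topPerm, add_smul, sum_add_distrib]
    ring

theorem topplingGroup_eq_range {n : ℕ} (G : SimpleGraph (Fin n)) [DecidableRel G.Adj] :
    topplingGroup G = (topPermHom G).range := by
  have h : Set.range (topPerm G) = (topPermHom G).range := rfl
  rw [topplingGroup, h, Subgroup.closure_eq]

theorem topPerm_eq_one_iff {n : ℕ} (G : SimpleGraph (Fin n)) [DecidableRel G.Adj]
    (a : Fin n → ℤ) : topPerm G a = 1 ↔ ∑ i, a i • topDelta G i = 0 := by
  constructor
  · intro h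
    simpa [topPerm] using DFunLike.congr_fun h 0
  · intro h
    rw [topPerm, h]
    ext
    simp

/-- The group algebra `ℂ[G]` of the toppling group of a connected graph is
isomorphic, as a `ℂ`-algebra, to `ℂ[x_1,…,x_n]/⟨1 − x_1 x_2 ⋯ x_n⟩`. -/
theorem groupAlgebra_iso (n : ℕ) (hn : 0 < n) (G : SimpleGraph (Fin n))
    [DecidableRel G.Adj] (hG : G.Connected) :
    Nonempty (MonoidAlgebra ℂ (topplingGroup G) ≃ₐ[ℂ]
      (MvPolynomial (Fin n) ℂ ⧸
        Ideal.span {(1 : MvPolynomial (Fin n) ℂ) - ∏ i, MvPolynomial.X i})) := by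
  rw [topplingGroup_eq_range]
  let f := (topPermHom G).rangeRestrict
  have hf : Function.Surjective f := (topPermHom G).rangeRestrict_surjective
  let _ : CommGroup (topPermHom G).range :=
    { mul_comm := hf.forall₂.2 fun a b => by rw [← map_mul, mul_comm, map_mul] }
  refine nonempty_monoidAlgebra_algEquiv_of_ker_eq_const f hf fun a => ?_
  rw [← sum_smul_topDelta_eq_zero_iff hn G hG, ← topPerm_eq_one_iff]
  exact Subtype.ext_iff
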